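/- arXiv:0903.0344 — 4 statements merged into one kernel-verified Lean document; each statement's English description precedes it below -/
import Mathlib

section
/- In the algebra C, the left annihilator of the matrix β' is generated by (np, np, −np): the set {(e₁,e₂,e₃) ∈ C³ : e₁s + e₃u = 0, −e₁s + e₂t = 0, −e₂t − e₃u = 0} equals the cyclic left C-submodule of C³ generated by the vector (np, np, −np). -/
noncomputable section

open FreeAlgebra

/-- Generators of the algebra `C`: `n, p, q, r, s, t, u, v, w`,
`x_1, …, x_{m-2}`, `y_1, …, y_{m-3}`, `z_1, …, z_{m-4}`. -/
inductive CGen (m : ℕ) : Type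
  | n | p | q | r | s | t | u | v | w
  | x (i : ℕ) (h1 : 1 ≤ i) (h2 : i ≤ m - 2)
  | y (i : ℕ) (h1 : 1 ≤ i) (h2 : i ≤ m - 3)
  | z (i : ℕ) (h1 : 1 ≤ i) (h2 : i ≤ m - 4)

/-- The defining relations of `C`, as a relation on the free algebra
(each generator `g` of the ideal contributes the pair `(g, 0)`). -/
inductive CRel (k : Type) [Field k] (m : ℕ) :
    FreeAlgebra k (CGen m) → FreeAlgebra k (CGen m) → Prop
  | np_nq : CRel k m (ι k CGen.n * ι k CGen.p - ι k CGen.n * ι k CGen.q) 0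
  | np_nr : CRel k m (ι k CGen.n * ι k CGen.p - ι k CGen.n * ι k CGen.r) 0
  | ps_pt : CRel k m (ι k CGen.p * ι k CGen.s - ι k CGen.p * ι k CGen.t) 0
  | qt_qu : CRel k m (ι k CGen.q * ι k CGen.t - ι k CGen.q * ι k CGen.u) 0
  | rs_ru : CRel k m (ι k CGen.r * ι k CGen.s - ι k CGen.r * ι k CGen.u) 0
  | sv_sw : CRel k m (ι k CGen.s * ι k CGen.v - ι k CGen.s * ι k CGen.w) 0
  | tw_tx (h : 1 ≤ m - 2) :
      CRel k m (ι k CGen.t * ι k CGen.w - ι k CGen.t * ι k (CGen.x 1 le_rfl h)) 0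
  | uv_ux (h : 1 ≤ m - 2) :
      CRel k m (ι k CGen.u * ι k CGen.v - ι k CGen.u * ι k (CGen.x 1 le_rfl h)) 0
  | vx2 (h : 2 ≤ m - 2) :
      CRel k m (ι k CGen.v * ι k (CGen.x 2 (by omega) h)) 0
  | wx2 (h : 2 ≤ m - 2) :
      CRel k m (ι k CGen.w * ι k (CGen.x 2 (by omega) h)) 0
  | sv_sy (h : 1 ≤ m - 3) :
      CRel k m (ι k CGen.s * ι k CGen.v - ι k CGen.s * ι k (CGen.y 1 le_rfl h)) 0
  | tw_ty (h : 1 ≤ m - 3) :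
      CRel k m (ι k CGen.t * ι k CGen.w - ι k CGen.t * ι k (CGen.y 1 le_rfl h)) 0
  | ux_uy (h2 : 1 ≤ m - 2) (h3 : 1 ≤ m - 3) :
      CRel k m (ι k CGen.u * ι k (CGen.x 1 le_rfl h2) -
        ι k CGen.u * ι k (CGen.y 1 le_rfl h3)) 0
  | sz (h : 1 ≤ m - 4) : CRel k m (ι k CGen.s * ι k (CGen.z 1 le_rfl h)) 0
  | tz (h : 1 ≤ m - 4) : CRel k m (ι k CGen.t * ι k (CGen.z 1 le_rfl h)) 0
  | uz (h : 1 ≤ m - 4) : CRel k m (ι k CGen.u * ι k (CGen.z 1 le_rfl h)) 0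
  | xx (i : ℕ) (h1 : 1 ≤ i) (h2 : i ≤ m - 3) :
      CRel k m (ι k (CGen.x i h1 (by omega)) *
        ι k (CGen.x (i + 1) (by omega) (by omega))) 0
  | yx_zy (i : ℕ) (h1 : 2 ≤ i) (h2 : i ≤ m - 3) :
      CRel k m (ι k (CGen.y (i - 1) (by omega) (by omega)) *
          ι k (CGen.x i (by omega) (by omega)) +
        ι k (CGen.z (i - 1) (by omega) (by omega)) * ι k (CGen.y i (by omega) h2)) 0
  | zz (i : ℕ) (h1 : 1 ≤ i) (h2 : i ≤ m - 5) :
      CRel k m (ι k (CGen.z i h1 (by omega)) *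
        ι k (CGen.z (i + 1) (by omega) (by omega))) 0

/-- The algebra `C`: the quotient of the free algebra by the two-sided ideal
generated by the relations. -/
abbrev Calg (k : Type) [Field k] (m : ℕ) : Type := RingQuot (CRel k m)

/-- The image in `C` of a generator. -/
def cgen (k : Type) [Field k] (m : ℕ) (g : CGen m) : Calg k m :=
  RingQuot.mkAlgHom k (CRel k m) (ι k g)

def cn (k : Type) [Field k] (m : ℕ) : Calg k m := cgen k m CGen.n
def cp (k : Type) [Field k] (m : ℕ) : Calg k m := cgen k m CGen.p
def cq (k : Type) [Field k] (m : ℕ) : Calg k m := cgen k m CGen.q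
def cr (k : Type) [Field k] (m : ℕ) : Calg k m := cgen k m CGen.r
def cs (k : Type) [Field k] (m : ℕ) : Calg k m := cgen k m CGen.s
def ct (k : Type) [Field k] (m : ℕ) : Calg k m := cgen k m CGen.t
def cu (k : Type) [Field k] (m : ℕ) : Calg k m := cgen k m CGen.u
def cv (k : Type) [Field k] (m : ℕ) : Calg k m := cgen k m CGen.v
def cw (k : Type) [Field k] (m : ℕ) : Calg k m := cgen k m CGen.w
def cx (k : Type) [Field k] (m : ℕ) (i : ℕ) (h1 : 1 ≤ i) (h2 : i ≤ m - 2) : Calg k m :=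
  cgen k m (CGen.x i h1 h2)
def cy (k : Type) [Field k] (m : ℕ) (i : ℕ) (h1 : 1 ≤ i) (h2 : i ≤ m - 3) : Calg k m :=
  cgen k m (CGen.y i h1 h2)
def cz (k : Type) [Field k] (m : ℕ) (i : ℕ) (h1 : 1 ≤ i) (h2 : i ≤ m - 4) : Calg k m :=
  cgen k m (CGen.z i h1 h2)

section FoxCalculus

variable {k X M : Type*} [Field k] {r : FreeAlgebra k X → FreeAlgebra k X → Prop}
  [AddCommGroup M] [Module k M] [Module (RingQuot r) M] [IsScalarTower k (RingQuot r) M]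

/-- The endomorphism of `M × k` by which a generator `g` acts: `g • x` on `M`, and `(0, 1)` is sent
to `(d g, 0)`. -/
def foxGen (d : X → M) (g : X) : Module.End k (M × k) :=
  LinearMap.inl k M k ∘ₗ
    ((Algebra.lsmul k k M (RingQuot.mkAlgHom k r (ι k g))).coprod
      (LinearMap.toSpanSingleton k M (d g)))

theorem foxGen_apply (d : X → M) (g : X) (a : M × k) :
    foxGen (r := r) d g a = (RingQuot.mkAlgHom k r (ι k g) • a.1 + a.2 • d g, 0) := by
  simp [foxGen]

theorem lift_foxGen_inl (d : X → M) (a : FreeAlgebra k X) (x : M) :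
    FreeAlgebra.lift k (foxGen (r := r) d) a (x, 0) = (RingQuot.mkAlgHom k r a • x, 0) := by
  induction a using FreeAlgebra.induction generalizing x with
  | grade0 c => simp
  | grade1 g => simp [foxGen_apply]
  | mul a b ha hb => simp [ha, hb, mul_smul]
  | add a b ha hb => simp [ha, hb, add_smul]

/-- If the Fox derivation attached to `d` respects the relations `r`, then a left linear relation
between generators also holds between their values under `d`. -/
theorem sum_smul_eq_zero_of_sum_mul_eq_zero (d : X → M)
    (hd : ∀ a b, r a b → FreeAlgebra.lift k (foxGen (r := r) d) a (0, 1) =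
      FreeAlgebra.lift k (foxGen (r := r) d) b (0, 1))
    {n : ℕ} (c : Fin n → RingQuot r) (g : Fin n → X)
    (h : ∑ i, c i * RingQuot.mkAlgHom k r (ι k (g i)) = 0) : ∑ i, c i • d (g i) = 0 := by
  have hr : ∀ ⦃a b⦄, r a b → FreeAlgebra.lift k (foxGen (r := r) d) a =
      FreeAlgebra.lift k (foxGen (r := r) d) b := by
    intro a b hab
    refine LinearMap.prod_ext (LinearMap.ext fun x => ?_) (LinearMap.ext_ring ?_)
    · simp [lift_foxGen_inl, RingQuot.mkAlgHom_rel k hab]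
    · simpa using hd a b hab
  let φ := RingQuot.liftAlgHom k ⟨FreeAlgebra.lift k (foxGen (r := r) d), hr⟩
  have hφ : ∀ (c : RingQuot r) (x : M), φ c (x, 0) = (c • x, 0) := by
    intro c x
    obtain ⟨a, rfl⟩ := RingQuot.mkAlgHom_surjective k r c
    simp [φ, lift_foxGen_inl]
  have hg : ∀ g : X, φ (RingQuot.mkAlgHom k r (ι k g)) (0, 1) = (d g, 0) := by
    intro g
    simp [φ, foxGen_apply]
  have := congrArg (fun y => (φ y (0, 1)).1) h
  simpa [hφ, hg, LinearMap.sum_apply, Prod.fst_sum] using this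

theorem lift_foxGen_mul_sub_mul (d : X → M) (g g' h h' : X) :
    FreeAlgebra.lift k (foxGen (r := r) d) (ι k g * ι k g' - ι k h * ι k h') (0, 1) =
      (RingQuot.mkAlgHom k r (ι k g) • d g' - RingQuot.mkAlgHom k r (ι k h) • d h', 0) := by
  simp [foxGen_apply]

end FoxCalculus

section Syzygies

variable {k : Type} [Field k] {m : ℕ}

/-- `neg_mul` in the instances that elaboration finds on `Calg k m`, which `rw` does not unify with
those of the general lemma. -/
theorem calg_neg_mul (a b : Calg k m) : -a * b = -(a * b) := neg_mul a b

/-- `mul_neg` in the instances that elaboration finds on `Calg k m`, which `rw` does not unify with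
those of the general lemma. -/
theorem calg_mul_neg (a b : Calg k m) : a * -b = -(a * b) := mul_neg a b

theorem cgen_eq_of_rel {a b : FreeAlgebra k (CGen m)} (h : CRel k m (a - b) 0) :
    RingQuot.mkAlgHom k (CRel k m) a = RingQuot.mkAlgHom k (CRel k m) b := by
  simpa [sub_eq_zero] using RingQuot.mkAlgHom_rel k h

theorem cn_mul_cq : cn k m * cq k m = cn k m * cp k m := by
  simpa [cn, cq, cp, cgen] using (cgen_eq_of_rel (CRel.np_nq (k := k) (m := m))).symm

theorem cn_mul_cr : cn k m * cr k m = cn k m * cp k m := by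
  simpa [cn, cr, cp, cgen] using (cgen_eq_of_rel (CRel.np_nr (k := k) (m := m))).symm

theorem cp_mul_ct : cp k m * ct k m = cp k m * cs k m := by
  simpa [cp, cs, ct, cgen] using (cgen_eq_of_rel (CRel.ps_pt (k := k) (m := m))).symm

theorem cr_mul_cu : cr k m * cu k m = cr k m * cs k m := by
  simpa [cr, cs, cu, cgen] using (cgen_eq_of_rel (CRel.rs_ru (k := k) (m := m))).symm

set_option maxHeartbeats 1000000 in
/-- The left syzygies of `(s, t, u)` are generated by those coming from the defining relations. -/
theorem exists_of_mul_stu_eq_zero {a b c : Calg k m}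
    (h : a * cs k m + b * ct k m + c * cu k m = 0) :
    ∃ α β γ : Calg k m, a = α * cp k m + γ * cr k m ∧ b = β * cq k m - α * cp k m ∧
      c = -(β * cq k m) - γ * cr k m := by
  let N : Submodule (Calg k m) (Fin 3 → Calg k m) := Submodule.span _
    {![cp k m, -cp k m, 0], ![0, cq k m, -cq k m], ![cr k m, 0, -cr k m]}
  let d : CGen m → (Fin 3 → Calg k m) ⧸ N := fun g => match g with
    | .s => N.mkQ ![1, 0, 0]
    | .t => N.mkQ ![0, 1, 0]
    | .u => N.mkQ ![0, 0, 1]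
    | _ => 0
  have key := sum_smul_eq_zero_of_sum_mul_eq_zero (r := CRel k m) d (by
    intro a b hab
    cases hab
    case ps_pt =>
      rw [lift_foxGen_mul_sub_mul, map_zero, LinearMap.zero_apply, Prod.mk_eq_zero]
      refine ⟨?_, rfl⟩
      simp only [d, ← map_smul, ← map_sub]
      refine (Submodule.Quotient.mk_eq_zero N).2 ?_
      have hN : ![cp k m, -cp k m, 0] ∈ N := Submodule.subset_span (by simp)
      refine (congrArg (· ∈ N) ?_).mpr hN
      ext i
      fin_cases i <;> simp [cp, cgen]
    case qt_qu =>
      rw [lift_foxGen_mul_sub_mul, map_zero, LinearMap.zero_apply, Prod.mk_eq_zero]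
      refine ⟨?_, rfl⟩
      simp only [d, ← map_smul, ← map_sub]
      refine (Submodule.Quotient.mk_eq_zero N).2 ?_
      have hN : ![0, cq k m, -cq k m] ∈ N := Submodule.subset_span (by simp)
      refine (congrArg (· ∈ N) ?_).mpr hN
      ext i
      fin_cases i <;> simp [cq, cgen]
    case rs_ru =>
      rw [lift_foxGen_mul_sub_mul, map_zero, LinearMap.zero_apply, Prod.mk_eq_zero]
      refine ⟨?_, rfl⟩
      simp only [d, ← map_smul, ← map_sub]
      refine (Submodule.Quotient.mk_eq_zero N).2 ?_
      have hN : ![cr k m, 0, -cr k m] ∈ N := Submodule.subset_span (by simp)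
      refine (congrArg (· ∈ N) ?_).mpr hN
      ext i
      fin_cases i <;> simp [cr, cgen]
    all_goals simp [foxGen_apply, d])
    ![a, b, c] ![.s, .t, .u] (by simpa [Fin.sum_univ_three, cs, ct, cu, cgen] using h)
  have hN : ![a, b, c] ∈ N := by
    rw [← Submodule.Quotient.mk_eq_zero, ← key]
    simp only [Fin.sum_univ_three, d]
    simp only [Matrix.cons_val, ← map_smul, ← map_add, ← Submodule.mkQ_apply]
    congr 1
    ext i
    fin_cases i <;> simp
  obtain ⟨α, β, γ, h⟩ := Submodule.mem_span_triple.1 hN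
  refine ⟨α, β, γ, ?_, ?_, ?_⟩
  · simpa using (congrFun h 0).symm
  · simpa [calg_mul_neg, sub_eq_neg_add] using (congrFun h 1).symm
  · simpa [calg_mul_neg, sub_eq_add_neg] using (congrFun h 2).symm

set_option maxHeartbeats 1000000 in
/-- The left syzygies of `(p, q, r)` are generated by those coming from the defining relations. -/
theorem exists_of_mul_pqr_eq_zero {a b c : Calg k m}
    (h : a * cp k m + b * cq k m + c * cr k m = 0) :
    ∃ α β : Calg k m, a = α * cn k m + β * cn k m ∧ b = -(α * cn k m) ∧ c = -(β * cn k m) := by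
  let N : Submodule (Calg k m) (Fin 3 → Calg k m) := Submodule.span _
    {![cn k m, -cn k m, 0], ![cn k m, 0, -cn k m]}
  let d : CGen m → (Fin 3 → Calg k m) ⧸ N := fun g => match g with
    | .p => N.mkQ ![1, 0, 0]
    | .q => N.mkQ ![0, 1, 0]
    | .r => N.mkQ ![0, 0, 1]
    | _ => 0
  have key := sum_smul_eq_zero_of_sum_mul_eq_zero (r := CRel k m) d (by
    intro a b hab
    cases hab
    case np_nq =>
      rw [lift_foxGen_mul_sub_mul, map_zero, LinearMap.zero_apply, Prod.mk_eq_zero]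
      refine ⟨?_, rfl⟩
      simp only [d, ← map_smul, ← map_sub]
      refine (Submodule.Quotient.mk_eq_zero N).2 ?_
      have hN : ![cn k m, -cn k m, 0] ∈ N := Submodule.subset_span (by simp)
      refine (congrArg (· ∈ N) ?_).mpr hN
      ext i
      fin_cases i <;> simp [cn, cgen]
    case np_nr =>
      rw [lift_foxGen_mul_sub_mul, map_zero, LinearMap.zero_apply, Prod.mk_eq_zero]
      refine ⟨?_, rfl⟩
      simp only [d, ← map_smul, ← map_sub]
      refine (Submodule.Quotient.mk_eq_zero N).2 ?_
      have hN : ![cn k m, 0, -cn k m] ∈ N := Submodule.subset_span (by simp)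
      refine (congrArg (· ∈ N) ?_).mpr hN
      ext i
      fin_cases i <;> simp [cn, cgen]
    all_goals simp [foxGen_apply, d])
    ![a, b, c] ![.p, .q, .r] (by simpa [Fin.sum_univ_three, cp, cq, cr, cgen] using h)
  have hN : ![a, b, c] ∈ N := by
    rw [← Submodule.Quotient.mk_eq_zero, ← key]
    simp only [Fin.sum_univ_three, d]
    simp only [Matrix.cons_val, ← map_smul, ← map_add, ← Submodule.mkQ_apply]
    congr 1
    ext i
    fin_cases i <;> simp
  obtain ⟨α, β, h⟩ := Submodule.mem_span_pair.1 hN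
  refine ⟨α, β, ?_, ?_, ?_⟩
  · simpa using (congrFun h 0).symm
  · simpa [calg_mul_neg] using (congrFun h 1).symm
  · simpa [calg_mul_neg] using (congrFun h 2).symm

end Syzygies

/-- In the algebra `C`, the left annihilator of the matrix `β'` is
generated by `(np, np, −np)`. -/
theorem stmt6 (k : Type) [Field k] (m : ℕ) (hm : 5 ≤ m) :
    {e : Fin 3 → Calg k m |
        e 0 * cs k m + e 2 * cu k m = 0 ∧
        -(e 0 * cs k m) + e 1 * ct k m = 0 ∧
        -(e 1 * ct k m) - e 2 * cu k m = 0}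
      = (Submodule.span (Calg k m)
          {![cn k m * cp k m, cn k m * cp k m, -(cn k m * cp k m)]} :
            Set (Fin 3 → Calg k m)) := by
  have hpt : cn k m * cp k m * ct k m = cn k m * cp k m * cs k m := by
    rw [mul_assoc, cp_mul_ct, mul_assoc]
  have hpu : cn k m * cp k m * cu k m = cn k m * cp k m * cs k m := by
    rw [← cn_mul_cr, mul_assoc, cr_mul_cu, mul_assoc]
  ext e
  rw [SetLike.mem_coe, Submodule.mem_span_singleton, Set.mem_ofPred_eq]
  constructor
  · rintro ⟨h1, h2, h3⟩
    obtain ⟨a, b, c, h0, hb, hbc⟩ := exists_of_mul_stu_eq_zero (a := e 0) (b := -e 1) (c := 0)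
      (neg_eq_zero.1 (Eq.trans (by rw [zero_mul, calg_neg_mul]; abel) h2))
    obtain ⟨α, β, hα, rfl, rfl⟩ := exists_of_mul_pqr_eq_zero (a := 0) (b := b) (c := c)
      (neg_eq_zero.1 (Eq.trans (by rw [zero_mul]; abel) hbc.symm))
    have hαβ : β * cn k m = -(α * cn k m) := eq_neg_of_add_eq_zero_right hα.symm
    have h1p : e 1 = (α * cn k m + a) * cp k m := by
      rw [← neg_neg (e 1), hb, calg_neg_mul, mul_assoc, cn_mul_cq, add_mul, mul_assoc]
      abel
    have h01 : e 0 = e 1 := by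
      rw [h0, h1p, hαβ, neg_neg, mul_assoc, cn_mul_cr, add_mul, mul_assoc, add_comm]
    have h02 : e 2 = -e 0 := by
      obtain ⟨a, b, c, h0, h1', h2'⟩ := exists_of_mul_stu_eq_zero (a := e 0) (b := 0) (c := e 2)
        (Eq.trans (by rw [zero_mul]; abel) h1)
      rw [h0, h2', sub_eq_zero.1 h1'.symm]
      abel
    obtain ⟨c, hc⟩ : ∃ c : Calg k m, e 1 = c * (cn k m * cp k m) := by
      obtain ⟨a', b, c, ha, hb, -⟩ := exists_of_mul_stu_eq_zero (a := 0) (b := e 1) (c := e 2)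
        (neg_eq_zero.1 (Eq.trans (by rw [zero_mul]; abel) h3))
      obtain ⟨δ, ε, hδ, hδ', -⟩ := exists_of_mul_pqr_eq_zero (a := a') (b := 0) (c := c)
        (Eq.trans (by rw [zero_mul]; abel) ha.symm)
      obtain ⟨γ, -, -, hγ, -⟩ := exists_of_mul_pqr_eq_zero (a := α * cn k m + a + a') (b := -b)
        (c := 0) (by rw [zero_mul, add_mul, calg_neg_mul, ← h1p, hb]; abel)
      refine ⟨γ - ε, ?_⟩
      rw [sub_eq_add_neg, add_mul, calg_neg_mul, hb, neg_inj.1 hγ, hδ, neg_eq_zero.1 hδ'.symm,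
        zero_add, mul_assoc, cn_mul_cq, mul_assoc, ← sub_eq_add_neg]
    refine ⟨c, ?_⟩
    ext i
    fin_cases i <;> simp [h02, h01, hc, calg_mul_neg]
  · rintro ⟨c, rfl⟩
    simp [mul_assoc c, hpt, hpu, calg_neg_mul, calg_mul_neg]
end
end

section
/- In the algebra C, the left annihilator of z₁ is the left ideal generated by s, t and u: {c ∈ C : c·z₁ = 0} = Cs + Ct + Cu. -/
noncomputable section

open FreeAlgebra

/-- The coefficient of the generator `z₁`. -/
def CGen.coeffZOne (k : Type) [Field k] {m : ℕ} : CGen m → k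
  | .z i _ _ => if i = 1 then 1 else 0
  | _ => 0

/-- For a left `C`-module `M` and `e : M`, the endomorphism `(a, l) ↦ (g a + l δ(g, z₁) e, 0)` of
`M × k` attached to a generator `g`. -/
def extAct (k : Type) [Field k] (m : ℕ) {M : Type} [AddCommGroup M] [Module k M]
    [Module (Calg k m) M] [IsScalarTower k (Calg k m) M] (e : M) (g : CGen m) :
    Module.End k (M × k) :=
  LinearMap.inl k M k ∘ₗ LinearMap.coprod (Algebra.lsmul k k M (cgen k m g))
    (LinearMap.toSpanSingleton k M (g.coeffZOne k • e))

section ExtRep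

variable {k : Type} [Field k] {m : ℕ} {M : Type} [AddCommGroup M] [Module k M]
  [Module (Calg k m) M] [IsScalarTower k (Calg k m) M]

theorem extAct_apply (e : M) (g : CGen m) (x : M × k) :
    extAct k m e g x = (cgen k m g • x.1 + x.2 • g.coeffZOne k • e, 0) := rfl

theorem mkAlgHom_ι (g : CGen m) : RingQuot.mkAlgHom k (CRel k m) (ι k g) = cgen k m g := rfl

theorem mkAlgHom_eq_zero_of_rel {a : FreeAlgebra k (CGen m)} (h : CRel k m a 0) :
    RingQuot.mkAlgHom k (CRel k m) a = 0 := by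
  rw [RingQuot.mkAlgHom_rel k h, map_zero]

theorem lift_extAct_eq_zero (e : M) (hs : cs k m • e = 0) (ht : ct k m • e = 0)
    (hu : cu k m • e = 0) {a b : FreeAlgebra k (CGen m)} (h : CRel k m a b) :
    FreeAlgebra.lift k (extAct k m e) a = FreeAlgebra.lift k (extAct k m e) b := by
  have hb : b = 0 := by cases h <;> rfl
  subst hb
  have key : ∀ y : M, RingQuot.mkAlgHom k (CRel k m) a • y = 0 := fun y => by
    rw [mkAlgHom_eq_zero_of_rel h, zero_smul]
  refine LinearMap.ext fun x => ?_
  have hx := key x.1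
  unfold cs at hs
  unfold ct at ht
  unfold cu at hu
  cases h <;>
    simp only [map_sub, map_add, map_mul, sub_smul, add_smul, mul_smul] at hx <;>
    simp only [mkAlgHom_ι] at hx <;>
    simp [extAct_apply, CGen.coeffZOne, hx]
  case sz => rw [smul_algebra_smul_comm, hs, smul_zero]
  case tz => rw [smul_algebra_smul_comm, ht, smul_zero]
  case uz => rw [smul_algebra_smul_comm, hu, smul_zero]
  case zz => omega

/-- The representation of `C` on `M × k` extending the action on `M` by `z₁ (0, 1) = (e, 0)`, where
all other generators kill `(0, 1)`. -/
def extRep (e : M) (hs : cs k m • e = 0) (ht : ct k m • e = 0) (hu : cu k m • e = 0) :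
    Calg k m →ₐ[k] Module.End k (M × k) :=
  RingQuot.liftAlgHom k
    ⟨FreeAlgebra.lift k (extAct k m e), fun _ _ h => lift_extAct_eq_zero e hs ht hu h⟩

theorem extRep_cgen (e : M) (hs : cs k m • e = 0) (ht : ct k m • e = 0) (hu : cu k m • e = 0)
    (g : CGen m) : extRep e hs ht hu (cgen k m g) = extAct k m e g := by
  simp [extRep, cgen]

theorem extRep_apply_inl (e : M) (hs : cs k m • e = 0) (ht : ct k m • e = 0)
    (hu : cu k m • e = 0) (c : Calg k m) (y : M) :
    extRep e hs ht hu c (y, 0) = (c • y, 0) := by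
  obtain ⟨a, rfl⟩ := RingQuot.mkAlgHom_surjective k (CRel k m) c
  induction a using FreeAlgebra.induction generalizing y with
  | grade0 r => simp [AlgHomClass.commutes, algebraMap_smul]
  | grade1 g =>
    change extRep e hs ht hu (cgen k m g) (y, 0) = (cgen k m g • y, 0)
    simp [extRep_cgen, extAct_apply]
  | mul a b ha hb => rw [map_mul, map_mul, Module.End.mul_apply, hb, ha, mul_smul]
  | add a b ha hb => simp [map_add, ha, hb, add_smul]

theorem smul_eq_zero_of_mul_cz_one_eq_zero (e : M) (hs : cs k m • e = 0) (ht : ct k m • e = 0)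
    (hu : cu k m • e = 0) (h : 1 ≤ m - 4) {c : Calg k m} (hc : c * cz k m 1 le_rfl h = 0) :
    c • e = 0 := by
  have H := LinearMap.congr_fun (congrArg (extRep e hs ht hu) hc) (0, 1)
  rw [map_mul, Module.End.mul_apply, cz, extRep_cgen, extAct_apply] at H
  simpa [CGen.coeffZOne, extRep_apply_inl] using H

end ExtRep

/-- In the algebra `C`, the left annihilator of `z₁` is the left
ideal generated by `s`, `t` and `u`: `{c ∈ C : c·z₁ = 0} = Cs + Ct + Cu`. -/
theorem stmt9 (k : Type) [Field k] (m : ℕ) (hm : 5 ≤ m) :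
    {c : Calg k m | c * cz k m 1 (by omega) (by omega) = 0}
      = (Submodule.span (Calg k m) {cs k m, ct k m, cu k m} : Set (Calg k m)) := by
  ext c
  simp only [Set.mem_ofPred_eq, SetLike.mem_coe]
  constructor
  · intro hc
    have hmem : ∀ g ∈ ({cs k m, ct k m, cu k m} : Set (Calg k m)),
        g • Submodule.Quotient.mk
          (p := Submodule.span (Calg k m) {cs k m, ct k m, cu k m}) (1 : Calg k m) = 0 := by
      intro g hg
      rw [← Submodule.Quotient.mk_smul, smul_eq_mul, mul_one, Submodule.Quotient.mk_eq_zero]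
      exact Submodule.subset_span hg
    have H := smul_eq_zero_of_mul_cz_one_eq_zero _ (hmem _ (by simp)) (hmem _ (by simp))
      (hmem _ (by simp)) _ hc
    rwa [← Submodule.Quotient.mk_smul, smul_eq_mul, mul_one, Submodule.Quotient.mk_eq_zero] at H
  · intro hc
    induction hc using Submodule.span_induction with
    | mem g hg =>
      rcases hg with rfl | rfl | rfl
      · simpa [mkAlgHom_ι, cs, cz] using
          mkAlgHom_eq_zero_of_rel (CRel.sz (k := k) (m := m) (by omega))
      · simpa [mkAlgHom_ι, ct, cz] using
          mkAlgHom_eq_zero_of_rel (CRel.tz (k := k) (m := m) (by omega))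
      · simpa [mkAlgHom_ι, cu, cz] using
          mkAlgHom_eq_zero_of_rel (CRel.uz (k := k) (m := m) (by omega))
    | zero => rw [zero_mul]
    | add a b _ _ ha hb => rw [add_mul, ha, hb, add_zero]
    | smul a b _ hb => rw [smul_eq_mul, mul_assoc, hb, mul_zero]
end
end

section
/- In the algebra C (with m ≥ 6), for every i with 1 ≤ i ≤ m−5, the element z_i generates the left annihilator of z_{i+1}: {c ∈ C : c·z_{i+1} = 0} = C·z_i. -/
noncomputable section

open FreeAlgebra

open Classical in
/-- The action of a generator `g` on an extension `M × k` of the trivial module `k` by `M`: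
it acts as usual on `M`, and sends `(0, 1)` to `e` if `g = g₀`, to `0` otherwise. -/
def genAction (k : Type) [Field k] (m : ℕ) {M : Type*} [AddCommGroup M] [Module k M]
    [Module (Calg k m) M] [IsScalarTower k (Calg k m) M] (e : M) (g₀ g : CGen m) :
    Module.End k (M × k) :=
  LinearMap.inl k _ _ ∘ₗ
    (Algebra.lsmul k k M (cgen k m g) ∘ₗ LinearMap.fst k _ _ +
      if g = g₀ then LinearMap.toSpanSingleton k _ e ∘ₗ LinearMap.snd k _ _ else 0)

open Classical in
theorem genAction_apply (k : Type) [Field k] (m : ℕ) {M : Type*} [AddCommGroup M] [Module k M]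
    [Module (Calg k m) M] [IsScalarTower k (Calg k m) M] (e : M)
    (g₀ g : CGen m) (v : M × k) :
    genAction k m e g₀ g v = (cgen k m g • v.1 + if g = g₀ then v.2 • e else 0, 0) := by
  unfold genAction
  split_ifs <;> simp

/-- If `z_i` kills `e`, the generators act on `M × k` compatibly with the relations of `C`,
because `z_i z_{i+1}` is the only relation with a term ending in `z_{i+1}`. -/
theorem lift_genAction_rel (k : Type) [Field k] (m i : ℕ) {M : Type*} [AddCommGroup M] [Module k M]
    [Module (Calg k m) M] [IsScalarTower k (Calg k m) M] (e : M) (h1 : 1 ≤ i) (hi : i + 1 ≤ m - 4)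
    (he : cz k m i h1 (by omega) • e = 0)
    ⦃a b : FreeAlgebra k (CGen m)⦄ (hab : CRel k m a b) :
    FreeAlgebra.lift k (genAction k m e (CGen.z (i + 1) (Nat.le_add_left 1 i) hi)) a =
      FreeAlgebra.lift k (genAction k m e (CGen.z (i + 1) (Nat.le_add_left 1 i) hi)) b := by
  have hrel (v : M) :
      RingQuot.mkAlgHom k (CRel k m) a • v = RingQuot.mkAlgHom k (CRel k m) b • v := by
    rw [RingQuot.mkAlgHom_rel k hab]
  refine LinearMap.ext fun v => ?_
  specialize hrel v.1
  cases hab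
  case zz j _ _ =>
    by_cases hj : j = i
    · subst hj
      rw [cz, cgen] at he
      simpa [genAction_apply, cgen, mul_smul, smul_comm _ v.2, he] using hrel
    · simpa [genAction_apply, cgen, mul_smul, hj] using hrel
  all_goals
    have : i ≠ 0 := by omega
    simpa [genAction_apply, cgen, mul_smul, sub_smul, add_smul, this] using hrel

/-- The extension of `k` by `M` on which `z_{i+1}` sends `(0, 1)` to `e` and all other generators
kill `(0, 1)`, as a representation of `C`. -/
def extAction (k : Type) [Field k] (m i : ℕ) {M : Type*} [AddCommGroup M] [Module k M]
    [Module (Calg k m) M] [IsScalarTower k (Calg k m) M] (e : M) (h1 : 1 ≤ i) (hi : i + 1 ≤ m - 4)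
    (he : cz k m i h1 (by omega) • e = 0) :
    Calg k m →ₐ[k] Module.End k (M × k) :=
  RingQuot.liftAlgHom k ⟨FreeAlgebra.lift k (genAction k m e (CGen.z (i + 1) (Nat.le_add_left 1 i) hi)),
    lift_genAction_rel k m i e h1 hi he⟩

theorem extAction_cgen (k : Type) [Field k] (m i : ℕ) {M : Type*} [AddCommGroup M] [Module k M]
    [Module (Calg k m) M] [IsScalarTower k (Calg k m) M] (e : M) (h1 : 1 ≤ i) (hi : i + 1 ≤ m - 4)
    (he : cz k m i h1 (by omega) • e = 0) (g : CGen m) :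
    extAction k m i e h1 hi he (cgen k m g) = genAction k m e (CGen.z (i + 1) (Nat.le_add_left 1 i) hi) g := by
  simp [extAction, cgen]

/-- `M` is a submodule of the extension. -/
theorem extAction_inl (k : Type) [Field k] (m i : ℕ) {M : Type*} [AddCommGroup M] [Module k M]
    [Module (Calg k m) M] [IsScalarTower k (Calg k m) M] (e : M) (h1 : 1 ≤ i) (hi : i + 1 ≤ m - 4)
    (he : cz k m i h1 (by omega) • e = 0) (c : Calg k m) (v : M) :
    extAction k m i e h1 hi he c (v, 0) = (c • v, 0) := by
  obtain ⟨a, rfl⟩ := RingQuot.mkAlgHom_surjective k (CRel k m) c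
  induction a using FreeAlgebra.induction generalizing v with
  | grade0 r => simp [AlgHom.commutes, Module.algebraMap_end_apply, algebraMap_smul]
  | grade1 g =>
    change extAction k m i e h1 hi he (cgen k m g) (v, 0) = (cgen k m g • v, 0)
    simp [extAction_cgen, genAction_apply]
  | mul a b ha hb => simp [mul_smul, ha, hb]
  | add a b ha hb => simp [add_smul, ha, hb]

/-- Anything in `C` that kills `z_{i+1}` from the left kills every vector killed by `z_i`. -/
theorem smul_eq_zero_of_mul_cz_eq_zero (k : Type) [Field k] (m i : ℕ) {M : Type*} [AddCommGroup M] [Module k M]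
    [Module (Calg k m) M] [IsScalarTower k (Calg k m) M] (e : M) (h1 : 1 ≤ i) (hi : i + 1 ≤ m - 4)
    (he : cz k m i h1 (by omega) • e = 0)
    {c : Calg k m} (hc : c * cz k m (i + 1) (Nat.le_add_left 1 i) hi = 0) : c • e = 0 := by
  have h := congrArg (fun d => (extAction k m i e h1 hi he d (0, 1)).1) hc
  simpa [cz, extAction_cgen, genAction_apply, extAction_inl] using h

/-- In the algebra `C` (with `m ≥ 6`), for every `i` with
`1 ≤ i ≤ m−5`, the element `z_i` generates the left annihilator of `z_{i+1}`:
`{c ∈ C : c·z_{i+1} = 0} = C·z_i`. -/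
theorem stmt10 (k : Type) [Field k] (m : ℕ) (hm : 6 ≤ m) :
    ∀ (i : ℕ) (h1 : 1 ≤ i) (h2 : i ≤ m - 5),
      {c : Calg k m | c * cz k m (i + 1) (by omega) (by omega) = 0}
        = (Submodule.span (Calg k m)
            {cz k m i (by omega) (by omega)} : Set (Calg k m)) := by
  intro i h1 h2
  ext c
  rw [Set.mem_ofPred_eq, SetLike.mem_coe]
  constructor
  · intro hc
    set J := Submodule.span (Calg k m) {cz k m i h1 (by omega)}
    have mk_smul_one (d : Calg k m) : d • J.mkQ 1 = J.mkQ d := by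
      rw [← map_smul, smul_eq_mul, mul_one]
    rw [← Submodule.ker_mkQ J, LinearMap.mem_ker, ← mk_smul_one]
    refine smul_eq_zero_of_mul_cz_eq_zero k m i _ h1 (by omega) ?_ hc
    rw [mk_smul_one, ← LinearMap.mem_ker, Submodule.ker_mkQ]
    exact Submodule.mem_span_singleton_self _
  · intro hc
    obtain ⟨a, rfl⟩ := Submodule.mem_span_singleton.mp hc
    have hz := RingQuot.mkAlgHom_rel k (CRel.zz (k := k) (m := m) i h1 h2)
    rw [map_mul, map_zero] at hz
    rw [smul_eq_mul, mul_assoc]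
    exact (congrArg (a * ·) hz).trans (mul_zero a)
end
end

section
/- In the algebra C (with m ≥ 6), the rows of γ generate the left annihilator of the matrix χ₂: the set {(e₁,e₂) ∈ C² : e₁x₂ + e₂y₂ = 0 and e₂z₂ = 0} equals the left C-submodule of C² generated by the four vectors (v,0), (w,0), (x₁,0), (y₁,z₁). -/
noncomputable section

open FreeAlgebra

section RightDerivative

variable {k : Type} [Field k] {m : ℕ} {M : Type} [AddCommGroup M] [Module k M]
  [Module (Calg k m) M] [IsScalarTower k (Calg k m) M]

/-- The operator on `M × k` through which a generator `g` acts on the extension of the trivial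
module `k` by `M` determined by the values `d`. -/
def extensionGen (d : CGen m → M) (g : CGen m) : Module.End k (M × k) :=
  ((Algebra.lsmul k k M (cgen k m g)).comp (LinearMap.fst k M k) +
    (LinearMap.toSpanSingleton k M (d g)).comp (LinearMap.snd k M k)).prod 0

@[simp]
theorem extensionGen_apply (d : CGen m → M) (g : CGen m) (e : M × k) :
    extensionGen d g e = (cgen k m g • e.1 + e.2 • d g, 0) := rfl

theorem lift_extensionGen_inl (d : CGen m → M) (a : FreeAlgebra k (CGen m)) (μ : M) :
    FreeAlgebra.lift k (extensionGen d) a (μ, (0 : k)) =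
      (RingQuot.mkAlgHom k (CRel k m) a • μ, 0) := by
  induction a using FreeAlgebra.induction generalizing μ with
  | grade0 c => simp [Module.algebraMap_end_apply]
  | grade1 g => simp [cgen]
  | mul a b ha hb => simp [ha, hb, mul_smul]
  | add a b ha hb => simp [ha, hb, add_smul]

/-- Values `d` on the generators compatible with the defining relations extend to a
representation of `C`. -/
def extensionRep (d : CGen m → M)
    (hd : ∀ a b, CRel k m a b → FreeAlgebra.lift k (extensionGen d) a (0, (1 : k)) =
      FreeAlgebra.lift k (extensionGen d) b (0, (1 : k))) :
    Calg k m →ₐ[k] Module.End k (M × k) :=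
  RingQuot.liftAlgHom k ⟨FreeAlgebra.lift k (extensionGen d), fun a b h => by
    refine LinearMap.ext fun ⟨μ, c⟩ => ?_
    have he : ((μ, c) : M × k) = (μ, 0) + c • (0, 1) := by simp
    rw [he, map_add, map_add, map_smul, map_smul, hd a b h, lift_extensionGen_inl,
      lift_extensionGen_inl, RingQuot.mkAlgHom_rel k h]⟩

theorem smul_add_smul_eq_zero (d : CGen m → M)
    (hd : ∀ a b, CRel k m a b → FreeAlgebra.lift k (extensionGen d) a (0, (1 : k)) =
      FreeAlgebra.lift k (extensionGen d) b (0, (1 : k)))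
    {a b : Calg k m} {g h : CGen m} (hab : a * cgen k m g + b * cgen k m h = 0) :
    a • d g + b • d h = 0 := by
  obtain ⟨a, rfl⟩ := RingQuot.mkAlgHom_surjective k (CRel k m) a
  obtain ⟨b, rfl⟩ := RingQuot.mkAlgHom_surjective k (CRel k m) b
  have := congrArg (fun c => (extensionRep d hd c (0, 1)).1) hab
  simpa [extensionRep, cgen, lift_extensionGen_inl] using this

end RightDerivative

/-- The coordinates of a generator along `x₂` and `y₂`. -/
def coordXY (k : Type) [Field k] (m : ℕ) : CGen m → Fin 2 → Calg k m
  | .x i _ _ => if i = 2 then ![1, 0] else 0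
  | .y i _ _ => if i = 2 then ![0, 1] else 0
  | _ => 0

theorem cgen_mul_cgen_eq_zero {k : Type} [Field k] {m : ℕ} {g h : CGen m}
    (hr : CRel k m (ι k g * ι k h) 0) : cgen k m g * cgen k m h = 0 := by
  simpa [cgen] using RingQuot.mkAlgHom_rel k hr

/-- In the algebra `C` (with `m ≥ 6`), the rows of `γ` generate
the left annihilator of the matrix `χ₂`. -/
theorem stmt12 (k : Type) [Field k] (m : ℕ) (hm : 6 ≤ m) :
    {e : Fin 2 → Calg k m |
        e 0 * cx k m 2 (by omega) (by omega) + e 1 * cy k m 2 (by omega) (by omega) = 0 ∧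
        e 1 * cz k m 2 (by omega) (by omega) = 0}
      = (Submodule.span (Calg k m)
          {![cv k m, 0], ![cw k m, 0], ![cx k m 1 (by omega) (by omega), 0],
           ![cy k m 1 (by omega) (by omega), cz k m 1 (by omega) (by omega)]} :
            Set (Fin 2 → Calg k m)) := by
  apply Set.Subset.antisymm
  · rintro e ⟨he, -⟩
    set N := Submodule.span (Calg k m)
      {![cv k m, 0], ![cw k m, 0], ![cx k m 1 (by omega) (by omega), 0],
       ![cy k m 1 (by omega) (by omega), cz k m 1 (by omega) (by omega)]}
    have hv : ![cv k m, 0] ∈ N := Submodule.subset_span (by simp)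
    have hw : ![cw k m, 0] ∈ N := Submodule.subset_span (by simp)
    have hx : ![cx k m 1 (by omega) (by omega), 0] ∈ N := Submodule.subset_span (by simp)
    have hyz : ![cy k m 1 (by omega) (by omega), cz k m 1 (by omega) (by omega)] ∈ N :=
      Submodule.subset_span (by simp)
    have key := smul_add_smul_eq_zero (k := k) (M := (Fin 2 → Calg k m) ⧸ N)
      (fun g => N.mkQ (coordXY k m g)) (fun a b hab => ?_) he
    · rw [← map_smul, ← map_smul, ← map_add, Submodule.mkQ_apply,
        Submodule.Quotient.mk_eq_zero] at key
      have hcoord : e = e 0 • coordXY k m (.x 2 (by omega) (by omega)) +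
          e 1 • coordXY k m (.y 2 (by omega) (by omega)) := by
        ext i
        fin_cases i <;> simp [coordXY]
      exact hcoord ▸ key
    · cases hab
      case xx i h1 h2 =>
        rcases eq_or_ne i 1 with rfl | hi
        · simpa [coordXY, ← Submodule.Quotient.mk_smul, cx] using hx
        · simp [coordXY, hi]
      case yx_zy i h1 h2 =>
        rcases eq_or_ne i 2 with rfl | hi
        · simpa [coordXY, ← Submodule.Quotient.mk_smul, ← Submodule.Quotient.mk_add,
            cy, cz] using hyz
        · simp [coordXY, hi]
      case vx2 => simpa [coordXY, ← Submodule.Quotient.mk_smul, cv] using hv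
      case wx2 => simpa [coordXY, ← Submodule.Quotient.mk_smul, cw] using hw
      all_goals simp [coordXY]
  · have hyx : cgen k m (.y 1 le_rfl (by omega)) * cgen k m (.x 2 (by omega) (by omega)) +
        cgen k m (.z 1 le_rfl (by omega)) * cgen k m (.y 2 (by omega) (by omega)) = 0 := by
      simpa [cgen] using RingQuot.mkAlgHom_rel k (CRel.yx_zy (k := k) 2 le_rfl (by omega))
    have hvx := cgen_mul_cgen_eq_zero (CRel.vx2 (k := k) (m := m) (by omega))
    have hwx := cgen_mul_cgen_eq_zero (CRel.wx2 (k := k) (m := m) (by omega))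
    have hxx := cgen_mul_cgen_eq_zero (CRel.xx (k := k) (m := m) 1 le_rfl (by omega))
    have hzz := cgen_mul_cgen_eq_zero (CRel.zz (k := k) (m := m) 1 le_rfl (by omega))
    intro e he
    induction he using Submodule.span_induction with
    | mem e he =>
      rcases he with rfl | rfl | rfl | rfl <;>
        simp_all [cv, cw, cx, cy, cz]
    | zero => simp
    | add e f _ _ he hf =>
      constructor
      · rw [Pi.add_apply, Pi.add_apply, add_mul, add_mul, add_add_add_comm, he.1, hf.1, add_zero]
      · rw [Pi.add_apply, add_mul, he.2, hf.2, add_zero]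
    | smul c e _ he =>
      constructor
      · rw [Pi.smul_apply, Pi.smul_apply, smul_mul_assoc, smul_mul_assoc, ← smul_add, he.1,
          smul_zero]
      · rw [Pi.smul_apply, smul_mul_assoc, he.2, smul_zero]
end
end
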